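/- Let c be additive and outcome monotonic, let π* be an outcome monotonic policy, and let i > 1 with q_i > γ be the index with the highest outcome (i.e. the smallest index) among indices at which π* violates the binary condition, and suppose π*(x_{i-1}) > π*(x_i) > π*(x_{i-1}) − c(x_i,x_{i-1}). Then the policy π' defined by π'(x_j) = π*(x_j) for all j ≠ i and π'(x_i) = π*(x_{i-1}) satisfies u(π',γ) ≥ u(π*,γ). -/

import Mathlib

open scoped Classical

/-- The best response of an individual with features `x i` to policy `π` under cost `c`:
the element of `argmax_k (π k - c i k)` with the highest outcome and, among maximizers
with equal outcome, the lowest index.  Since indices are sorted in decreasing order of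
outcome, this is the minimal index among the maximizers. -/
noncomputable def bestResponse {m : ℕ} [NeZero m] (c : Fin m → Fin m → ℝ)
    (π : Fin m → ℝ) (i : Fin m) : Fin m :=
  (Finset.univ.filter (fun k => ∀ l, π l - c i l ≤ π k - c i k)).min' (by
    obtain ⟨k, -, hk⟩ := Finset.exists_max_image Finset.univ (fun k => π k - c i k)
      ⟨i, Finset.mem_univ i⟩
    exact ⟨k, Finset.mem_filter.mpr ⟨Finset.mem_univ k, fun l => hk l (Finset.mem_univ l)⟩⟩)

/-- The utility of a decision policy `π`:  `u(π,γ) = Σ_i P(x_i) · π(x_{br_π(i)}) · (q_{br_π(i)} − γ)`. -/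
noncomputable def utility {m : ℕ} [NeZero m] (P q : Fin m → ℝ) (c : Fin m → Fin m → ℝ)
    (γ : ℝ) (π : Fin m → ℝ) : ℝ :=
  ∑ i, P i * π (bestResponse c π i) * (q (bestResponse c π i) - γ)

/-- A decision policy takes values in `[0,1]`. -/
def IsPolicy {m : ℕ} (π : Fin m → ℝ) : Prop := ∀ i, 0 ≤ π i ∧ π i ≤ 1


theorem bestResponse_isMax {m : ℕ} [NeZero m] (c : Fin m → Fin m → ℝ) (π : Fin m → ℝ)
    (j l : Fin m) : π l - c j l ≤ π (bestResponse c π j) - c j (bestResponse c π j) :=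
  (Finset.mem_filter.mp (Finset.min'_mem
    (Finset.univ.filter (fun k => ∀ l, π l - c j l ≤ π k - c j k)) _)).2 l

theorem bestResponse_le {m : ℕ} [NeZero m] (c : Fin m → Fin m → ℝ) (π : Fin m → ℝ)
    (j k : Fin m) (hk : ∀ l, π l - c j l ≤ π k - c j k) : bestResponse c π j ≤ k :=
  Finset.min'_le _ _ (Finset.mem_filter.mpr ⟨Finset.mem_univ k, hk⟩)

/-- If consecutive drops of `π` are bounded by the cost of the corresponding step, additivity
bounds every drop of `π` by the cost. -/
theorem sub_le_cost_of_consecutive {m : ℕ} {c : Fin m → Fin m → ℝ} {π : Fin m → ℝ} {b : Fin m}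
    (hcdiag : ∀ i, c i i = 0)
    (hcadd : ∀ i j k : Fin m, j ≤ k → k ≤ i → c i j = c i k + c k j)
    (hstep : ∀ k k' : Fin m, (k' : ℕ) + 1 = (k : ℕ) → k ≤ b → π k' - π k ≤ c k k')
    (k l : Fin m) (hkl : k ≤ l) (hlb : l ≤ b) : π k - π l ≤ c l k := by
  obtain ⟨n, hn⟩ := l
  induction n with
  | zero =>
    have hk : k = ⟨0, hn⟩ := le_antisymm hkl (Nat.zero_le _)
    simp [hk, hcdiag]
  | succ n ih =>
    rcases hkl.eq_or_lt with rfl | hlt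
    · simp [hcdiag]
    have hn' : n < m := by omega
    have hk : k ≤ ⟨n, hn'⟩ := Nat.lt_succ_iff.mp hlt
    have hle : (⟨n, hn'⟩ : Fin m) ≤ ⟨n + 1, hn⟩ := Nat.le_succ n
    linarith [ih hn' hk (hle.trans hlb), hstep ⟨n + 1, hn⟩ ⟨n, hn'⟩ rfl hlb,
      hcadd ⟨n + 1, hn⟩ k ⟨n, hn'⟩ hk hle]

/-- First case in the proof of Theorem 2: if `i` is the smallest index (highest outcome)
at which the outcome monotonic policy `π*` violates the binary condition and
`π* ip > π* i > π* ip − c i ip` (where `ip` is the predecessor of `i`), then raising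
`π* i` to `π* ip` does not decrease utility. -/
theorem stmt8 {m : ℕ} [NeZero m]
    (P q : Fin m → ℝ) (c : Fin m → Fin m → ℝ) (γ : ℝ)
    (hP : ∀ i, 0 ≤ P i) (hPsum : ∑ i, P i = 1)
    (hq : ∀ i, 0 ≤ q i ∧ q i ≤ 1)
    (hsort : ∀ i j : Fin m, i < j → q j ≤ q i)
    (hcdiag : ∀ i, c i i = 0) (hcnonneg : ∀ i j, 0 ≤ c i j)
    (hctri : ∀ i j k, c i k ≤ c i j + c j k)
    (hcpos : ∀ i j, i ≠ j → q i ≤ q j → 0 < c i j)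
    (hγ0 : 0 < γ) (hγ1 : γ < 1)
    (hcm0 : ∀ i j, q j < q i → c i j = 0)
    (hcm1 : ∀ i j k, q i < q j → q j < q k → c i j < c i k)
    (hcm2 : ∀ i j k, q k < q j → q j < q i → c j i < c k i)
    (hcadd : ∀ i j k : Fin m, j ≤ k → k ≤ i → c i j = c i k + c k j)
    (πstar : Fin m → ℝ) (hπstar : IsPolicy πstar)
    (hmono : ∀ i j, q i < q j ↔ πstar i < πstar j)
    (i ip : Fin m) (hip : (ip : ℕ) + 1 = (i : ℕ)) (hqi : γ < q i)
    (hviol₁ : πstar i < πstar ip) (hviol₂ : πstar ip - c i ip < πstar i)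
    (hmin : ∀ k k' : Fin m, (k' : ℕ) + 1 = (k : ℕ) → γ < q k → k < i →
      (πstar k = πstar k' ∨ πstar k = πstar k' - c k k')) :
    utility P q c γ πstar ≤
      utility P q c γ (fun j => if j = i then πstar ip else πstar j) := by
  have hanti : ∀ a b : Fin m, a ≤ b → πstar b ≤ πstar a := fun a b hab => by
    rcases hab.eq_or_lt with rfl | hlt
    · exact le_rfl
    · exact not_lt.mp fun h => (hsort a b hlt).not_gt ((hmono a b).mpr h)
  have hqanti : ∀ a b : Fin m, a ≤ b → q b ≤ q a := fun a b hab => by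
    rcases hab.eq_or_lt with rfl | hlt
    · exact le_rfl
    · exact hsort a b hlt
  have hlt_i : ip < i := Fin.lt_def.mpr (by omega)
  have hdrop : ∀ k, k ≤ ip → πstar k - πstar ip ≤ c ip k := fun k hk => by
    refine sub_le_cost_of_consecutive hcdiag hcadd (fun a a' ha hle => ?_) k ip hk le_rfl
    rcases hmin a a' ha (hqi.trans_le (hqanti a i (hle.trans hlt_i.le)))
      (hle.trans_lt hlt_i) with h | h
    · linarith [hcnonneg a a']
    · linarith
  set π' : Fin m → ℝ := fun j => if j = i then πstar ip else πstar j with hπ'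
  have hi : π' i = πstar ip := if_pos rfl
  have hne : ∀ l, l ≠ i → π' l = πstar l := fun l hl => if_neg hl
  have hle' : ∀ l, πstar l ≤ π' l := fun l => by
    by_cases hl : l = i
    · rw [hl, hi]; exact hviol₁.le
    · rw [hne l hl]
  have hbr : ∀ j, (bestResponse c π' j = i ∧ i ≤ bestResponse c πstar j) ∨
      (bestResponse c π' j = bestResponse c πstar j ∧ bestResponse c πstar j ≠ i) := fun j => by
    have hmax := bestResponse_isMax c πstar j
    have hmax' := bestResponse_isMax c π' j
    have hlow' := bestResponse_le c π' j
    have hlow := bestResponse_le c πstar j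
    generalize bestResponse c πstar j = b at *
    generalize bestResponse c π' j = b' at *
    by_cases hb' : b' = i
    · subst hb'
      refine Or.inl ⟨rfl, not_lt.mp fun hb => ?_⟩
      have hstrict : πstar b - c j b < πstar ip - c j b' := by
        by_contra! h
        refine (hlow' b fun l => (hmax' l).trans ?_).not_gt hb
        rwa [hi, hne b hb.ne]
      have hbip : b ≤ ip := Fin.le_def.mpr (by have := Fin.lt_def.mp hb; omega)
      rcases lt_or_ge j b' with hj | hj
      · have hjip : j ≤ ip := Fin.le_def.mpr (by have := Fin.lt_def.mp hj; omega)
        linarith [hmax j, hanti j ip hjip, hcdiag j, hcnonneg j b']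
      · linarith [hmax b', hcadd j b b' hb.le hj, hcadd b' b ip hbip hlt_i.le, hdrop b hbip]
    · have hbi : b ≠ i := by
        rintro rfl
        have h₁ := hmax b'
        have h₂ := hmax' b
        rw [hi, hne b' hb'] at h₂
        linarith
      refine Or.inr ⟨le_antisymm (hlow' b fun l => (hmax' l).trans ?_) (hlow b' fun l => ?_), hbi⟩
      · rw [hne b hbi, hne b' hb']
        exact hmax b'
      · rw [← hne b' hb']
        linarith [hmax' l, hle' l]
  refine Finset.sum_le_sum fun j _ => ?_
  rw [mul_assoc, mul_assoc]
  refine mul_le_mul_of_nonneg_left ?_ (hP j)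
  rcases hbr j with ⟨h, hb⟩ | ⟨h, hb⟩
  · rw [h, hi]
    have hpos := (hπstar (bestResponse c πstar j)).1
    calc _ ≤ πstar (bestResponse c πstar j) * (q i - γ) :=
          mul_le_mul_of_nonneg_left (by linarith [hqanti _ _ hb]) hpos
      _ ≤ _ := mul_le_mul_of_nonneg_right ((hanti _ _ hb).trans hviol₁.le) (by linarith)
  · rw [h, hne _ hb]
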